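/- arXiv:2112.13033 — 2 statements merged into one kernel-verified Lean document; each statement's English description precedes it below -/
import Mathlib

section
/- For α ∈ (1,2) and λ > 0, as x → 0, (1/π)∫₀^∞ (1−cos(xθ))/(λ+θ^α) dθ is asymptotically equivalent to c·|x|^{α−1}, where c = (1/π)∫₀^∞ (1−cos y)/y^α dy = Γ(2−α)·sin(πα/2)/(π(α−1)). -/
open MeasureTheory Real Set Filter

lemma swapL (f : ℝ → ℝ → ℝ) (g h : ℝ → ℝ) (hf : Measurable (Function.uncurry f))
    (hg : Measurable g) (hh : Measurable h)
    (h0 : ∀ y > 0, ∀ t > 0, 0 ≤ f y t)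
    (hgi : ∀ y > 0, IntegrableOn (f y) (Ioi 0)) (hge : ∀ y > 0, ∫ t in Ioi 0, f y t = g y)
    (hhi : ∀ t > 0, IntegrableOn (fun y => f y t) (Ioi 0))
    (hhe : ∀ t > 0, ∫ y in Ioi 0, f y t = h t) :
    ∫ y in Ioi 0, g y = ∫ t in Ioi 0, h t := by
  have g0 : ∀ y > 0, 0 ≤ g y := fun y hy => by
    rw [← hge y hy]; exact setIntegral_nonneg measurableSet_Ioi (fun t ht => h0 y hy t ht)
  have hh0 : ∀ y > 0, 0 ≤ h y := fun y hy => by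
    rw [← hhe y hy]; exact setIntegral_nonneg measurableSet_Ioi (fun t ht => h0 t ht y hy)
  rw [integral_eq_lintegral_of_nonneg_ae, integral_eq_lintegral_of_nonneg_ae]
  · congr 1
    have e1 : ∫⁻ y in Ioi 0, ENNReal.ofReal (g y)
        = ∫⁻ y in Ioi 0, ∫⁻ t in Ioi 0, ENNReal.ofReal (f y t) := by
      refine setLIntegral_congr_fun measurableSet_Ioi (fun y hy => ?_)
      rw [← hge y hy, ofReal_integral_eq_lintegral_ofReal (hgi y hy)]
      exact (ae_restrict_mem measurableSet_Ioi).mono (fun t ht => h0 y hy t ht)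
    have e2 : ∫⁻ y in Ioi 0, ENNReal.ofReal (h y)
        = ∫⁻ t in Ioi 0, ∫⁻ y in Ioi 0, ENNReal.ofReal (f y t) := by
      refine setLIntegral_congr_fun measurableSet_Ioi (fun y hy => ?_)
      rw [← hhe y hy, ofReal_integral_eq_lintegral_ofReal (hhi y hy)]
      exact (ae_restrict_mem measurableSet_Ioi).mono (fun t ht => h0 t ht y hy)
    rw [e1, e2]
    exact lintegral_lintegral_swap (hf.ennreal_ofReal.aemeasurable)
  · exact (ae_restrict_mem measurableSet_Ioi).mono (fun t ht => hh0 t ht)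
  · exact hh.aestronglyMeasurable
  · exact (ae_restrict_mem measurableSet_Ioi).mono (fun t ht => g0 t ht)
  · exact hg.aestronglyMeasurable

lemma lapl (t : ℝ) (ht : 0 < t) :
    IntegrableOn (fun y => (1 - Real.cos y) * Real.exp (-(t * y))) (Ioi 0) ∧
    ∫ y in Ioi 0, (1 - Real.cos y) * Real.exp (-(t * y)) = 1 / (t * (1 + t^2)) := by
  let F : ℝ → ℝ := fun y => Real.exp (-(t*y)) * (-(1 / t) - (Real.sin y - t * Real.cos y) / (1 + t^2))
  have hp : (1 + t^2) ≠ 0 := by positivity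
  have hd : ∀ y ∈ Ici (0:ℝ), HasDerivAt F ((1 - Real.cos y) * Real.exp (-(t * y))) y := by
    intro y _
    have h1 : HasDerivAt (fun y => Real.exp (-(t*y))) (Real.exp (-(t*y)) * (-(t*1))) y :=
      (((hasDerivAt_id y).const_mul t).neg).exp
    have h2 : HasDerivAt (fun y => -(1 / t) - (Real.sin y - t * Real.cos y) / (1 + t^2))
       (-((Real.cos y - t * (-Real.sin y)) / (1+t^2))) y :=
      ((((Real.hasDerivAt_sin y).sub ((Real.hasDerivAt_cos y).const_mul t)).div_const _).const_sub _)
    refine (h1.mul h2).congr_deriv ?_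
    field_simp
    ring
  have hn : ∀ y ∈ Ioi (0:ℝ), 0 ≤ (1 - Real.cos y) * Real.exp (-(t * y)) := fun y _ =>
    mul_nonneg (by linarith [Real.cos_le_one y]) (Real.exp_pos _).le
  have hl : Tendsto F atTop (nhds 0) := by
    have he : Tendsto (fun y => Real.exp (-(t*y))) atTop (nhds 0) :=
      Real.tendsto_exp_neg_atTop_nhds_zero.comp (tendsto_id.const_mul_atTop ht)
    refine he.zero_mul_isBoundedUnder_le ?_
    refine isBoundedUnder_of ⟨1/t + (1 + t)/(1+t^2), fun y => ?_⟩
    simp only [Function.comp, Real.norm_eq_abs]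
    have : |Real.sin y - t * Real.cos y| ≤ 1 + t := by
      refine (abs_sub _ _).trans ?_
      rw [abs_mul, abs_of_pos ht]
      nlinarith [Real.abs_sin_le_one y, Real.abs_cos_le_one y]
    refine (abs_sub _ _).trans ?_
    rw [abs_neg, abs_of_pos (by positivity : 0 < 1/t), abs_div, abs_of_pos (by positivity : 0 < 1+t^2)]
    gcongr
  refine ⟨integrableOn_Ioi_deriv_of_nonneg' hd hn hl, ?_⟩
  rw [integral_Ioi_of_hasDerivAt_of_nonneg' hd hn hl]
  simp [F]
  field_simp
  ring

lemma scal (α lam : ℝ) (hα : 1 < α) (x : ℝ) (hx : x ≠ 0) :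
   ∫ θ in Ioi (0:ℝ), (1 - Real.cos (x * θ)) / (lam + θ ^ α) = 
    |x| ^ (α - 1) * ∫ y in Ioi (0:ℝ), (1 - Real.cos y) / (lam * |x| ^ α + y ^ α) := by
  have hx' : 0 < |x| := abs_pos.2 hx
  have := integral_comp_mul_left_Ioi (fun y => (1 - Real.cos y) / (lam * |x| ^ α + y ^ α)) 0 hx'
  rw [mul_zero] at this
  have h2 : ∫ y in Ioi (0:ℝ), (1 - Real.cos y) / (lam * |x| ^ α + y ^ α) = |x| *
     ∫ y in Ioi (0:ℝ), (1 - Real.cos (|x| * y)) / (lam * |x| ^ α + (|x| * y) ^ α) := by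
    rw [this]; simp [hx]
  rw [h2, ← mul_assoc, ← integral_const_mul]
  refine setIntegral_congr_fun measurableSet_Ioi (fun y hy => ?_)
  have hy : 0 < y := hy
  have e1 : |x| ^ (α - 1) * |x| = |x| ^ α := by
    rw [← Real.rpow_add_one hx'.ne']; simp
  have e2 : Real.cos (|x| * y) = Real.cos (x * y) := by
    rw [← Real.cos_abs (x * y), abs_mul, abs_of_pos hy]
  rw [e1, e2, Real.mul_rpow hx'.le hy.le]
  have : 0 < |x| ^ α := by positivity
  rw [show lam * |x|^α + |x|^α * y^α = |x|^α * (lam + y^α) by ring, mul_div_assoc',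
    mul_div_mul_left _ _ this.ne']

lemma limL (α lam : ℝ) (hα : 1 < α) (hlam : 0 < lam)
    (hi : IntegrableOn (fun y => (1 - Real.cos y) / y ^ α) (Ioi 0)) :
    Tendsto (fun x : ℝ => ∫ y in Ioi (0:ℝ), (1 - Real.cos y) / (lam * |x| ^ α + y ^ α))
     (nhdsWithin 0 {0}ᶜ) (nhds (∫ y in Ioi (0:ℝ), (1 - Real.cos y) / y ^ α)) := by
  refine tendsto_integral_filter_of_dominated_convergence _ ?_ ?_ hi ?_
  · exact Eventually.of_forall fun x => (by fun_prop : Measurable _).aestronglyMeasurable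
  · refine Eventually.of_forall fun x => (ae_restrict_mem measurableSet_Ioi).mono fun y hy => ?_
    have hy : 0 < y := hy
    have h1 : 0 ≤ 1 - Real.cos y := by linarith [Real.cos_le_one y]
    have : 0 ≤ lam * |x| ^ α := by positivity
    rw [Real.norm_of_nonneg (by positivity)]
    gcongr
    linarith
  · refine (ae_restrict_mem measurableSet_Ioi).mono fun y hy => ?_
    have hy : 0 < y := hy
    have hc : Tendsto (fun x : ℝ => lam * |x| ^ α + y ^ α) (nhds 0) (nhds (lam * |0| ^ α + y ^ α)) := by
      refine ((Tendsto.rpow_const ?_ (Or.inr (by linarith))).const_mul _).add_const _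
      exact continuous_abs.tendsto 0
    rw [abs_zero, Real.zero_rpow (by linarith), mul_zero, zero_add] at hc
    exact (tendsto_const_nhds.div hc (by positivity)).mono_left nhdsWithin_le_nhds

/-- `∫ t^(s-1)/(1+t^2)`. -/
lemma betaL (s : ℝ) (h0 : 0 < s) (h1 : s < 1) :
    ∫ t in Ioi (0:ℝ), t ^ (s - 1) / (1 + t ^ 2) = π / (2 * Real.sin (π * s / 2)) := by
  have key := swapL (fun t u => t ^ (s - 1) * Real.exp (-((1 + t^2) * u)))
    (fun t => t ^ (s - 1) / (1 + t ^ 2))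
    (fun u => Real.exp (-u) * (u ^ (-s / 2) * (1 / 2) * Real.Gamma (s / 2)))
    (by unfold Function.uncurry; fun_prop) (by fun_prop) (by fun_prop)
    (fun y hy t ht => by have := Real.exp_pos (-((1 + y^2) * t)); positivity)
    (fun t ht => by
      have := integrableOn_rpow_mul_exp_neg_mul_rpow (s := 0) (p := 1) (b := 1 + t^2) (by norm_num) (by norm_num) (by positivity)
      simp only [Real.rpow_zero, one_mul, Real.rpow_one] at this
      refine (this.const_mul (t ^ (s-1))).congr ?_
      exact Eventually.of_forall fun u => by simp only [neg_mul])
    (fun t ht => by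
      have := Real.integral_rpow_mul_exp_neg_mul_Ioi (a := 1) (r := 1 + t^2) (by norm_num) (by positivity)
      simp only [sub_self, Real.rpow_zero, one_mul, Real.rpow_one, Real.Gamma_one, mul_one] at this
      rw [integral_const_mul, this]; ring)
    (fun u hu => by
      have := integrableOn_rpow_mul_exp_neg_mul_rpow (s := s - 1) (p := 2) (b := u) (by linarith) (by norm_num) hu
      refine (this.const_mul (Real.exp (-u))).congr ?_
      refine Eventually.of_forall fun t => ?_
      simp only [Real.rpow_two]
      rw [mul_left_comm, ← Real.exp_add]; ring_nf)
    (fun u hu => by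
      have := integral_rpow_mul_exp_neg_mul_rpow (p := 2) (q := s - 1) (b := u) (by norm_num) (by linarith) hu
      rw [show (s - 1 + 1) = s by ring] at this
      rw [← this, ← integral_const_mul]
      congr 1; ext t
      simp only [Real.rpow_two]
      rw [mul_left_comm, ← Real.exp_add]; ring_nf)
  rw [key]
  have hg := Real.Gamma_eq_integral (s := 1 - s / 2) (by linarith)
  have e : ∫ u in Ioi (0:ℝ), Real.exp (-u) * (u ^ (-s / 2) * (1 / 2) * Real.Gamma (s / 2))
     = Real.Gamma (s/2) * Real.Gamma (1 - s/2) / 2 := by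
    rw [hg, mul_div_right_comm, ← integral_const_mul]
    congr 1; ext u
    rw [show 1 - s/2 - 1 = -s/2 by ring]; ring
  rw [e, Real.Gamma_mul_Gamma_one_sub, div_div, mul_comm, mul_div_assoc]

lemma valL (α : ℝ) (hα : 1 < α) (hα2 : α < 2) :
    ∫ y in Ioi (0:ℝ), (1 - Real.cos y) / y ^ α
      = Real.Gamma (2 - α) * Real.sin (π * α / 2) / (α - 1) := by
  have hG : 0 < Real.Gamma α := Real.Gamma_pos_of_pos (by linarith)
  have key := swapL (fun y t => (1 - Real.cos y) * (t ^ (α - 1) * Real.exp (-(y * t))))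
    (fun y => (1 - Real.cos y) * ((1 / y) ^ α * Real.Gamma α))
    (fun t => t ^ (α - 1) * (1 / (t * (1 + t ^ 2))))
    (by unfold Function.uncurry; fun_prop) (by fun_prop) (by fun_prop)
    (fun y hy t ht => by
      have := Real.exp_pos (-(y * t))
      have h1 : 0 ≤ 1 - Real.cos y := by linarith [Real.cos_le_one y]
      positivity)
    (fun y hy => by
      have := integrableOn_rpow_mul_exp_neg_mul_rpow (s := α - 1) (p := 1) (b := y) (by linarith) (by norm_num) hy
      simp only [Real.rpow_one] at this
      refine (this.const_mul (1 - Real.cos y)).congr ?_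
      simp)
    (fun y hy => by
      rw [integral_const_mul, Real.integral_rpow_mul_exp_neg_mul_Ioi (by linarith) hy])
    (fun t ht => by
      refine ((lapl t ht).1.const_mul (t ^ (α - 1))).congr ?_
      refine Eventually.of_forall fun y => ?_
      dsimp only; rw [mul_comm t y]; ring)
    (fun t ht => by
      rw [← (lapl t ht).2, ← integral_const_mul]
      congr 1; ext y
      rw [mul_comm t y]; ring)
  have e1 : ∫ y in Ioi (0:ℝ), (1 - Real.cos y) * ((1 / y) ^ α * Real.Gamma α)
      = Real.Gamma α * ∫ y in Ioi (0:ℝ), (1 - Real.cos y) / y ^ α := by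
    rw [← integral_const_mul]
    refine setIntegral_congr_fun measurableSet_Ioi (fun y hy => ?_)
    have hy : 0 < y := hy
    rw [one_div, Real.inv_rpow hy.le]; ring
  have e2 : ∫ t in Ioi (0:ℝ), t ^ (α - 1) * (1 / (t * (1 + t ^ 2)))
      = ∫ t in Ioi (0:ℝ), t ^ (α - 1 - 1) / (1 + t ^ 2) := by
    refine setIntegral_congr_fun measurableSet_Ioi (fun t ht => ?_)
    have ht : 0 < t := ht
    rw [Real.rpow_sub_one ht.ne' (α - 1)]
    field_simp
  rw [e1, e2, betaL (α - 1) (by linarith) (by linarith)] at key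
  have hG1 : Real.Gamma α = (α - 1) * Real.Gamma (α - 1) := by
    have := Real.Gamma_add_one (s := α - 1) (by linarith)
    rwa [sub_add_cancel] at this
  have hr := Real.Gamma_mul_Gamma_one_sub (α - 1)
  rw [show 1 - (α - 1) = 2 - α by ring] at hr
  have hs : 0 < Real.sin (π * (α - 1) / 2) := by
    apply Real.sin_pos_of_pos_of_lt_pi
    · have := Real.pi_pos
      have : 0 < α - 1 := by linarith
      positivity
    · nlinarith [Real.pi_pos]
  have hs2 : 0 < Real.sin (π * α / 2) := by
    apply Real.sin_pos_of_pos_of_lt_pi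
    · have := Real.pi_pos
      positivity
    · nlinarith [Real.pi_pos]
  have hd : Real.sin (π * (α - 1)) = 2 * Real.sin (π * (α - 1) / 2) * Real.sin (π * α / 2) := by
    rw [show π * (α - 1) = 2 * (π * (α - 1) / 2) by ring, Real.sin_two_mul,
      show π * α / 2 = π * (α - 1) / 2 + π / 2 by ring, Real.sin_add_pi_div_two]
    ring_nf
  rw [hd] at hr
  have ha : α - 1 ≠ 0 := by linarith
  have hg1 : 0 < Real.Gamma (α - 1) := Real.Gamma_pos_of_pos (by linarith)
  apply mul_left_cancel₀ hG.ne'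
  rw [key, hG1]
  have : (α - 1) * Real.Gamma (α - 1) * (Real.Gamma (2 - α) * Real.sin (π * α / 2) / (α - 1))
    = (Real.Gamma (α - 1) * Real.Gamma (2 - α)) * Real.sin (π * α / 2) := by field_simp
  rw [this, hr]
  field_simp

theorem stmt_3 (α lam : ℝ) (hα : 1 < α) (hα2 : α < 2) (hlam : 0 < lam) :
    (1 / π) * (∫ y in Ioi (0:ℝ), (1 - Real.cos y) / y ^ α)
      = Real.Gamma (2 - α) * Real.sin (π * α / 2) / (π * (α - 1)) ∧
    Tendsto
      (fun x : ℝ =>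
        ((1 / π) * ∫ θ in Ioi (0:ℝ), (1 - Real.cos (x * θ)) / (lam + θ ^ α))
          / (Real.Gamma (2 - α) * Real.sin (π * α / 2) / (π * (α - 1)) * |x| ^ (α - 1)))
      (nhdsWithin 0 {0}ᶜ) (nhds 1) := by
  have hv := valL α hα hα2
  have ha : 0 < α - 1 := by linarith
  have hpi := Real.pi_pos
  have hs2 : 0 < Real.sin (π * α / 2) := by
    apply Real.sin_pos_of_pos_of_lt_pi
    · positivity
    · nlinarith
  have hg : 0 < Real.Gamma (2 - α) := Real.Gamma_pos_of_pos (by linarith)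
  have hc : (1 / π) * (∫ y in Ioi (0:ℝ), (1 - Real.cos y) / y ^ α)
      = Real.Gamma (2 - α) * Real.sin (π * α / 2) / (π * (α - 1)) := by
    rw [hv]; field_simp
  refine ⟨hc, ?_⟩
  have hpos : 0 < ∫ y in Ioi (0:ℝ), (1 - Real.cos y) / y ^ α := by rw [hv]; positivity
  have hi : IntegrableOn (fun y => (1 - Real.cos y) / y ^ α) (Ioi 0) := by
    by_contra hcon
    exact hpos.ne' (integral_undef hcon)
  have hl := (limL α lam hα hlam hi).div_const (∫ y in Ioi (0:ℝ), (1 - Real.cos y) / y ^ α)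
  rw [div_self hpos.ne'] at hl
  refine hl.congr' ?_
  filter_upwards [self_mem_nhdsWithin] with x hx
  have hx : x ≠ 0 := hx
  rw [← hc, scal α lam hα x hx]
  have : 0 < |x| ^ (α - 1) := Real.rpow_pos_of_pos (abs_pos.2 hx) _
  field_simp
end

section
/- Let σ be a nonnegative random variable such that λ ↦ E(1 − e^{−λσ}) ∼ c·λ^{1−1/α} as λ → 0+, for some constant c > 0 and α ∈ (1,2). Then P(σ > y) ∼ (c/Γ(1/α))·y^{−(1−1/α)} as y → +∞. -/
open MeasureTheory Real Set Filter

/-- The Laplace-type functional `∫₀^∞ g(e^{-sx}) e^{-sx} w(x) dx`. -/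
noncomputable def karI (w : ℝ → ℝ) (s : ℝ) (g : ℝ → ℝ) : ℝ :=
  ∫ x in Ioi (0:ℝ), g (exp (-(s * x))) * (exp (-(s * x)) * w x)

/-- Admissible weights. -/
def KarAdm (w : ℝ → ℝ) : Prop :=
  (∀ x, 0 < x → 0 ≤ w x) ∧
    ∀ s, 0 < s → IntegrableOn (fun x => exp (-(s * x)) * w x) (Ioi (0:ℝ))

lemma kar_exp_mem {s x : ℝ} (hs : 0 < s) (hx : 0 < x) : exp (-(s * x)) ∈ Icc (0:ℝ) 1 :=
  ⟨(exp_pos _).le, by rw [exp_le_one_iff]; have := mul_pos hs hx; linarith⟩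

lemma kar_integrable {w : ℝ → ℝ} (hw : KarAdm w) {s : ℝ} (hs : 0 < s) {g : ℝ → ℝ}
    (hg : Continuous g) :
    IntegrableOn (fun x => g (exp (-(s * x))) * (exp (-(s * x)) * w x)) (Ioi (0:ℝ)) := by
  obtain ⟨B, hB⟩ := (isCompact_Icc (a := (0:ℝ)) (b := 1)).exists_bound_of_continuousOn
    hg.continuousOn
  refine Integrable.bdd_mul (c := B) (hw.2 s hs) ?_ ?_
  · exact (by fun_prop : Continuous fun x : ℝ => g (exp (-(s * x)))).aestronglyMeasurable
  · filter_upwards [ae_restrict_mem measurableSet_Ioi] with x hx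
    exact hB _ (kar_exp_mem hs hx)

lemma kar_add {w : ℝ → ℝ} (hw : KarAdm w) {s : ℝ} (hs : 0 < s) {g h : ℝ → ℝ}
    (hg : Continuous g) (hh : Continuous h) :
    karI w s (fun u => g u + h u) = karI w s g + karI w s h := by
  unfold karI
  rw [← integral_add (kar_integrable hw hs hg) (kar_integrable hw hs hh)]
  congr 1; ext x; ring

lemma kar_monomial (w : ℝ → ℝ) (s a : ℝ) (n : ℕ) :
    karI w s (fun u => a * u ^ n) = a * ∫ x in Ioi (0:ℝ), exp (-(((n + 1) * s) * x)) * w x := by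
  unfold karI
  rw [← integral_const_mul]
  congr 1; ext x
  have : exp (-((((n:ℝ) + 1) * s) * x)) = exp (-(s * x)) ^ n * exp (-(s * x)) := by
    rw [← exp_nat_mul, ← exp_add]; congr 1; ring
  rw [this]; ring

lemma kar_close {w : ℝ → ℝ} (hw : KarAdm w) {s : ℝ} (hs : 0 < s) {g h : ℝ → ℝ}
    (hg : Continuous g) (hh : Continuous h) {ε : ℝ} (he : ∀ u ∈ Icc (0:ℝ) 1, |g u - h u| ≤ ε) :
    |karI w s g - karI w s h| ≤ ε * ∫ x in Ioi (0:ℝ), exp (-(s * x)) * w x := by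
  unfold karI
  rw [← integral_sub (kar_integrable hw hs hg) (kar_integrable hw hs hh), ← integral_const_mul,
    ← Real.norm_eq_abs]
  refine norm_integral_le_of_norm_le ((hw.2 s hs).const_mul ε) ?_
  filter_upwards [ae_restrict_mem measurableSet_Ioi] with x hx
  rw [← sub_mul, norm_mul, Real.norm_eq_abs, Real.norm_eq_abs,
    abs_of_nonneg (mul_nonneg (exp_pos _).le (hw.1 x hx))]
  exact mul_le_mul_of_nonneg_right (he _ (kar_exp_mem hs hx))
    (mul_nonneg (exp_pos _).le (hw.1 x hx))

lemma kar_mono {w v : ℝ → ℝ} (hw : KarAdm w) (hv : KarAdm v) {s : ℝ} (hs : 0 < s) {g : ℝ → ℝ}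
    (hg : Continuous g) (h : ∀ x, 0 < x → g (exp (-(s * x))) * w x ≤ g (exp (-(s * x))) * v x) :
    karI w s g ≤ karI v s g := by
  refine setIntegral_mono_on (kar_integrable hw hs hg) (kar_integrable hv hs hg)
    measurableSet_Ioi ?_
  intro x hx
  have := mul_le_mul_of_nonneg_left (h x hx) (exp_pos (-(s * x))).le
  nlinarith

/-- Convergence for all continuous `g`, from convergence of the Laplace transform. -/
lemma kar_tendsto {F v : ℝ → ℝ} (hF : KarAdm F) (hv : KarAdm v) {ρ : ℝ}
    (hlap : ∀ k : ℕ, Tendsto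
      (fun s : ℝ => s ^ (1 - ρ) * ∫ x in Ioi (0:ℝ), exp (-(((k + 1) * s) * x)) * F x)
      (nhdsWithin 0 (Ioi 0)) (nhds (∫ x in Ioi (0:ℝ), exp (-(((k + 1) * 1) * x)) * v x)))
    {g : ℝ → ℝ} (hg : Continuous g) :
    Tendsto (fun s : ℝ => s ^ (1 - ρ) * karI F s g) (nhdsWithin 0 (Ioi 0))
      (nhds (karI v 1 g)) := by
  have hpos : ∀ᶠ s : ℝ in nhdsWithin 0 (Ioi 0), 0 < s := eventually_mem_nhdsWithin
  have hpoly : ∀ p : Polynomial ℝ, Tendsto (fun s : ℝ => s ^ (1 - ρ) * karI F s (fun u => p.eval u))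
      (nhdsWithin 0 (Ioi 0)) (nhds (karI v 1 (fun u => p.eval u))) := by
    intro p
    induction p using Polynomial.induction_on' with
    | add p q hp hq =>
      simp only [Polynomial.eval_add]
      rw [kar_add hv one_pos p.continuous q.continuous]
      refine (hp.add hq).congr' ?_
      filter_upwards [hpos] with s hs
      rw [kar_add hF hs p.continuous q.continuous]; ring
    | monomial n a =>
      simp only [Polynomial.eval_monomial]
      rw [kar_monomial]
      refine ((hlap n).const_mul a).congr ?_
      intro s
      rw [kar_monomial]; ring
  set L : ℝ := ∫ x in Ioi (0:ℝ), exp (-(1 * x)) * v x with hL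
  have h0 := hlap 0
  simp only [Nat.cast_zero, zero_add, one_mul] at h0
  have hL' : (∫ x in Ioi (0:ℝ), exp (-x) * v x) = L := by simp [hL]
  rw [hL'] at h0
  have hL0 : 0 ≤ L := setIntegral_nonneg measurableSet_Ioi
    (fun x hx => mul_nonneg (exp_pos _).le (hv.1 x hx))
  rw [Metric.tendsto_nhds]
  intro ε hε
  set δ := ε / (3 * (L + 1)) with hδ
  have hδ0 : 0 < δ := by positivity
  have hδL : δ * (L + 1) = ε / 3 := by rw [hδ]; field_simp
  obtain ⟨p, hp⟩ := exists_polynomial_near_of_continuousOn 0 1 g hg.continuousOn δ hδ0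
  have hb := h0.eventually (gt_mem_nhds (lt_add_one L))
  have hq := (Metric.tendsto_nhds.1 (hpoly p)) (ε / 3) (by positivity)
  filter_upwards [hpos, hb, hq] with s hs hb hq
  rw [Real.dist_eq] at hq ⊢
  have hs' : (0:ℝ) ≤ s ^ (1 - ρ) := (rpow_pos_of_pos hs _).le
  have e1 := kar_close hF hs p.continuous hg (ε := δ) (fun u hu => (hp u hu).le)
  have e2 := kar_close hv one_pos p.continuous hg (ε := δ) (fun u hu => (hp u hu).le)
  rw [← hL] at e2
  have e3 := mul_le_mul_of_nonneg_left e1 hs'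
  have e4 : s ^ (1 - ρ) * (δ * ∫ x in Ioi (0:ℝ), exp (-(s * x)) * F x) ≤ δ * (L + 1) := by
    rw [mul_left_comm]
    exact mul_le_mul_of_nonneg_left hb.le hδ0.le
  have e5 : |s ^ (1 - ρ) * karI F s (fun u => p.eval u) - s ^ (1 - ρ) * karI F s g| ≤ ε / 3 := by
    rw [← mul_sub, abs_mul, abs_of_nonneg hs']; linarith
  have e6 : |karI v 1 (fun u => p.eval u) - karI v 1 g| ≤ ε / 3 := by nlinarith
  rw [abs_le] at e5 e6
  rw [abs_lt] at hq ⊢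
  constructor <;> linarith [hq.1, hq.2, e5.1, e5.2, e6.1, e6.2]

/-- bump function -/
noncomputable def karB (a b : ℝ) (u : ℝ) : ℝ := max 0 ((u - exp (-b)) * (exp (-a) - u))

lemma karB_cont (a b : ℝ) : Continuous (karB a b) := by unfold karB; fun_prop

lemma karB_nonneg (a b u : ℝ) : 0 ≤ karB a b u := le_max_left _ _

lemma karB_zero {a b t : ℝ} (hab : a < b) (h : t < a ∨ b < t) : karB a b (exp (-t)) = 0 := by
  unfold karB
  apply max_eq_left
  have h1 : exp (-b) < exp (-a) := by rw [exp_lt_exp]; linarith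
  rcases h with h | h
  · have h2 : exp (-a) < exp (-t) := by rw [exp_lt_exp]; linarith
    nlinarith
  · have h2 : exp (-t) < exp (-b) := by rw [exp_lt_exp]; linarith
    nlinarith

lemma karB_pos {a b t : ℝ} (h1 : a < t) (h2 : t < b) : 0 < karB a b (exp (-t)) := by
  unfold karB
  apply lt_max_of_lt_right
  apply mul_pos <;> rw [sub_pos, exp_lt_exp] <;> linarith

lemma kar_adm_const {c : ℝ} (hc : 0 ≤ c) : KarAdm (fun _ => c) := by
  refine ⟨fun _ _ => hc, fun s hs => ?_⟩
  have := (exp_neg_integrableOn_Ioi 0 hs).mul_const c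
  simpa [IntegrableOn] using this

lemma kar_const (c s : ℝ) (g : ℝ → ℝ) : karI (fun _ => c) s g = c * karI (fun _ => 1) s g := by
  unfold karI
  rw [← integral_const_mul]; congr 1; ext x; ring

lemma kar_scale {s : ℝ} (hs : 0 < s) (g : ℝ → ℝ) :
    karI (fun _ => 1) s g = s⁻¹ * karI (fun _ => 1) 1 g := by
  unfold karI
  have := integral_comp_mul_left_Ioi (fun x => g (exp (-x)) * (exp (-x) * 1)) 0 hs
  simpa using this

lemma kar_K_pos {a b : ℝ} (ha : 0 < a) (hab : a < b) : 0 < karI (fun _ => 1) 1 (karB a b) := by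
  unfold karI
  rw [setIntegral_pos_iff_support_of_nonneg_ae]
  · refine lt_of_lt_of_le ?_ (measure_mono (s := Ioo a b) ?_)
    · simp [hab]
    · rintro x ⟨h1, h2⟩
      refine ⟨?_, ha.trans h1⟩
      have := karB_pos h1 h2
      simp only [Function.mem_support, one_mul, mul_one]
      exact (mul_pos this (exp_pos _)).ne'
  · exact Eventually.of_forall fun x => mul_nonneg (karB_nonneg _ _ _) (by positivity)
  · exact kar_integrable (kar_adm_const zero_le_one) one_pos (karB_cont a b)

lemma kar_adm_rpow {C ρ : ℝ} (hC : 0 ≤ C) (hρ : ρ < 1) : KarAdm (fun x => C * x ^ (-ρ)) := by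
  refine ⟨fun x hx => mul_nonneg hC (rpow_nonneg hx.le _), fun s hs => ?_⟩
  have := (integrableOn_rpow_mul_exp_neg_mul_rpow (s := -ρ) (p := 1) (b := s) (by linarith)
    one_pos hs).const_mul C
  refine Integrable.congr this ?_
  refine Eventually.of_forall fun x => ?_
  simp only [rpow_one, neg_mul]; ring

lemma kar_monotone_density {F : ℝ → ℝ} (hF : KarAdm F) (hanti : Antitone F) {ρ C : ℝ}
    (hρ0 : 0 < ρ) (hρ : ρ < 1) (hC : 0 < C)
    (hlap : ∀ k : ℕ, Tendsto
      (fun s : ℝ => s ^ (1 - ρ) * ∫ x in Ioi (0:ℝ), exp (-(((k + 1) * s) * x)) * F x)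
      (nhdsWithin 0 (Ioi 0))
      (nhds (∫ x in Ioi (0:ℝ), exp (-(((k + 1) * 1) * x)) * (C * x ^ (-ρ))))) :
    Tendsto (fun s : ℝ => s ^ (-ρ) * F (1 / s)) (nhdsWithin 0 (Ioi 0)) (nhds C) := by
  have hv := kar_adm_rpow hC.le hρ
  have hpos : ∀ᶠ s : ℝ in nhdsWithin 0 (Ioi 0), 0 < s := eventually_mem_nhdsWithin
  have hcont : ContinuousAt (fun a : ℝ => C * a ^ (-ρ)) 1 :=
    (continuousAt_const.mul (continuousAt_id.rpow_const (Or.inl one_ne_zero)))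
  have hcont' : Tendsto (fun a : ℝ => C * a ^ (-ρ)) (nhds 1) (nhds C) := by
    have := hcont.tendsto
    simpa using this
  have hsc : ∀ s : ℝ, 0 < s → s ^ (1 - ρ) * s⁻¹ = s ^ (-ρ) := by
    intro s hs
    rw [← rpow_neg_one s, ← rpow_add hs]; congr 1; ring
  have hFnn : ∀ x, 0 < x → 0 ≤ F x := hF.1
  rw [tendsto_order]
  constructor
  · intro q hq
    have h1 := (hcont'.mono_left nhdsWithin_le_nhds).eventually (lt_mem_nhds hq)
      (l₁ := nhdsWithin 1 (Ioi 1))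
    obtain ⟨b, hb, hb1⟩ := (h1.and eventually_mem_nhdsWithin).exists
    have hb1 : (1:ℝ) < b := hb1
    have hK := kar_K_pos one_pos hb1
    set K := karI (fun _ => 1) 1 (karB 1 b) with hKdef
    have hT := kar_tendsto hF hv hlap (karB_cont 1 b)
    have hJ : C * b ^ (-ρ) * K ≤ karI (fun x => C * x ^ (-ρ)) 1 (karB 1 b) := by
      rw [hKdef, ← kar_const]
      refine kar_mono (kar_adm_const (by positivity)) hv one_pos (karB_cont _ _) ?_
      intro x hx
      rcases lt_or_ge b x with h | h
      · rw [one_mul, karB_zero hb1 (Or.inr h)]; simp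
      · refine mul_le_mul_of_nonneg_left ?_ (karB_nonneg _ _ _)
        exact mul_le_mul_of_nonneg_left (rpow_le_rpow_of_nonpos hx h (by linarith)) hC.le
    have hlt : q * K < karI (fun x => C * x ^ (-ρ)) 1 (karB 1 b) :=
      (mul_lt_mul_of_pos_right hb hK).trans_le hJ
    filter_upwards [hpos, hT.eventually (lt_mem_nhds hlt)] with s hs h
    have hFs : 0 ≤ F (1 / s) := hFnn _ (by positivity)
    have hI : karI F s (karB 1 b) ≤ F (1 / s) * (s⁻¹ * K) := by
      rw [hKdef, ← kar_scale hs, ← kar_const]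
      refine kar_mono hF (kar_adm_const hFs) hs (karB_cont _ _) ?_
      intro x hx
      rcases lt_or_ge (s * x) 1 with h | h
      · rw [karB_zero hb1 (Or.inl h)]; simp
      · refine mul_le_mul_of_nonneg_left (hanti ?_) (karB_nonneg _ _ _)
        rw [div_le_iff₀ hs]; linarith
    have := mul_le_mul_of_nonneg_left hI (rpow_pos_of_pos hs (1 - ρ)).le
    have e : s ^ (1 - ρ) * (F (1 / s) * (s⁻¹ * K)) = s ^ (-ρ) * F (1 / s) * K := by
      rw [← hsc s hs]; ring
    rw [e] at this
    exact lt_of_mul_lt_mul_right (h.trans_le this) hK.le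
  · intro q hq
    have h1 := (hcont'.mono_left nhdsWithin_le_nhds).eventually (gt_mem_nhds hq)
      (l₁ := nhdsWithin 1 (Iio 1))
    have h2 : ∀ᶠ a : ℝ in nhdsWithin 1 (Iio 1), 0 < a :=
      nhdsWithin_le_nhds (lt_mem_nhds one_pos)
    obtain ⟨a, ⟨ha, ha0⟩, ha1⟩ := ((h1.and h2).and eventually_mem_nhdsWithin).exists
    have ha1 : a < 1 := ha1
    have hK := kar_K_pos ha0 ha1
    set K := karI (fun _ => 1) 1 (karB a 1) with hKdef
    have hT := kar_tendsto hF hv hlap (karB_cont a 1)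
    have hJ : karI (fun x => C * x ^ (-ρ)) 1 (karB a 1) ≤ C * a ^ (-ρ) * K := by
      rw [hKdef, ← kar_const]
      refine kar_mono hv (kar_adm_const (by positivity)) one_pos (karB_cont _ _) ?_
      intro x hx
      rcases lt_or_ge x a with h | h
      · rw [one_mul, karB_zero ha1 (Or.inl h)]; simp
      · refine mul_le_mul_of_nonneg_left ?_ (karB_nonneg _ _ _)
        exact mul_le_mul_of_nonneg_left (rpow_le_rpow_of_nonpos ha0 h (by linarith)) hC.le
    have hlt : karI (fun x => C * x ^ (-ρ)) 1 (karB a 1) < q * K :=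
      hJ.trans_lt (mul_lt_mul_of_pos_right ha hK)
    filter_upwards [hpos, hT.eventually (gt_mem_nhds hlt)] with s hs h
    have hFs : 0 ≤ F (1 / s) := hFnn _ (by positivity)
    have hI : F (1 / s) * (s⁻¹ * K) ≤ karI F s (karB a 1) := by
      rw [hKdef, ← kar_scale hs, ← kar_const]
      refine kar_mono (kar_adm_const hFs) hF hs (karB_cont _ _) ?_
      intro x hx
      rcases lt_or_ge 1 (s * x) with h | h
      · rw [karB_zero ha1 (Or.inr h)]; simp
      · refine mul_le_mul_of_nonneg_left (hanti ?_) (karB_nonneg _ _ _)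
        rw [le_div_iff₀ hs]; linarith
    have := mul_le_mul_of_nonneg_left hI (rpow_pos_of_pos hs (1 - ρ)).le
    have e : s ^ (1 - ρ) * (F (1 / s) * (s⁻¹ * K)) = s ^ (-ρ) * F (1 / s) * K := by
      rw [← hsc s hs]; ring
    rw [e] at this
    exact lt_of_mul_lt_mul_right (this.trans_lt h) hK.le

lemma kar_layercake {Ω : Type*} [MeasurableSpace Ω] (P : Measure Ω) [IsProbabilityMeasure P]
    (σ : Ω → ℝ) (hσmeas : Measurable σ) (hσ0 : ∀ ω, 0 ≤ σ ω) {s : ℝ} (hs : 0 < s)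
    (hF : KarAdm (fun x => (P {ω | x < σ ω}).toReal)) :
    ∫ x in Ioi (0:ℝ), exp (-(s * x)) * (P {ω | x < σ ω}).toReal
      = s⁻¹ * ∫ ω, (1 - exp (-s * σ ω)) ∂P := by
  have key := lintegral_comp_eq_lintegral_meas_lt_mul (f := σ)
    (g := fun t => s * exp (-(s * t))) P (Eventually.of_forall hσ0) hσmeas.aemeasurable
    (fun t _ => (by fun_prop : Continuous fun t : ℝ => s * exp (-(s * t))).intervalIntegrable _ _)
    (Eventually.of_forall fun t => by positivity)
  have hint : ∀ y : ℝ, ∫ t in (0:ℝ)..y, s * exp (-(s * t)) = 1 - exp (-s * y) := by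
    intro y
    have hd : ∀ t ∈ uIcc (0:ℝ) y, HasDerivAt (fun t => - exp (-(s * t))) (s * exp (-(s * t))) t := by
      intro t _
      have := (((hasDerivAt_id t).const_mul s).neg.exp).neg
      refine HasDerivAt.congr_deriv this ?_
      simp only [id, Pi.neg_apply]
      ring
    rw [intervalIntegral.integral_eq_sub_of_hasDerivAt hd
      ((by fun_prop : Continuous fun t : ℝ => s * exp (-(s * t))).intervalIntegrable _ _)]
    simp; ring
  simp only [hint] at key
  have h1 : ∫ ω, (1 - exp (-s * σ ω)) ∂P
      = (∫⁻ ω, ENNReal.ofReal (1 - exp (-s * σ ω)) ∂P).toReal := by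
    apply integral_eq_lintegral_of_nonneg_ae
    · refine Eventually.of_forall fun ω => ?_
      simp only [Pi.zero_apply, sub_nonneg, exp_le_one_iff]
      have := mul_nonneg hs.le (hσ0 ω); linarith
    · exact (by fun_prop : Measurable fun ω => 1 - exp (-s * σ ω)).aestronglyMeasurable
  have h2 : ∫ x in Ioi (0:ℝ), s * (exp (-(s * x)) * (P {ω | x < σ ω}).toReal)
      = (∫⁻ x in Ioi (0:ℝ), P {ω | x < σ ω} * ENNReal.ofReal (s * exp (-(s * x)))).toReal := by
    rw [integral_eq_lintegral_of_nonneg_ae]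
    · congr 1
      apply lintegral_congr
      intro x
      rw [← mul_assoc, mul_comm, ENNReal.ofReal_mul ENNReal.toReal_nonneg,
        ENNReal.ofReal_toReal (measure_ne_top _ _)]
    · exact Eventually.of_forall fun x => by simp only [Pi.zero_apply]; positivity
    · exact ((hF.2 s hs).const_mul s).aestronglyMeasurable
  rw [h1, key, ← h2, integral_const_mul, inv_mul_cancel_left₀ hs.ne']

/-- Tauberian theorem: if `E(1 − e^{-λσ}) ∼ c λ^{1-1/α}` as `λ → 0+`, then
`P(σ > y) ∼ (c/Γ(1/α)) y^{-(1-1/α)}` as `y → ∞`. -/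
theorem stmt_11 {Ω : Type*} [MeasurableSpace Ω] (P : Measure Ω) [IsProbabilityMeasure P]
    (σ : Ω → ℝ) (hσmeas : Measurable σ) (hσ0 : ∀ ω, 0 ≤ σ ω)
    (α c : ℝ) (hα : 1 < α) (hα2 : α < 2) (hc : 0 < c)
    (hLap : Tendsto
      (fun lam : ℝ => (∫ ω, (1 - Real.exp (-lam * σ ω)) ∂P) / (c * lam ^ (1 - 1 / α)))
      (nhdsWithin 0 (Ioi 0)) (nhds 1)) :
    Tendsto
      (fun y : ℝ =>
        (P {ω | y < σ ω}).toReal / ((c / Real.Gamma (1 / α)) * y ^ (-(1 - 1 / α))))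
      atTop (nhds 1) := by
  have hα0 : 0 < α := by linarith
  have hi0 : 0 < 1 / α := by positivity
  have hi1 : 1 / α < 1 := by rw [div_lt_one hα0]; exact hα
  set ρ := 1 - 1 / α with hρ
  have hρ0 : 0 < ρ := by linarith
  have hρ1 : ρ < 1 := by linarith
  have hG : 0 < Real.Gamma (1 / α) := Real.Gamma_pos_of_pos hi0
  have hC : 0 < c / Real.Gamma (1 / α) := by positivity
  set C := c / Real.Gamma (1 / α) with hCdef
  have hanti : Antitone (fun x => (P {ω | x < σ ω}).toReal) := by
    intro x y hxy
    exact ENNReal.toReal_mono (measure_ne_top _ _)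
      (measure_mono fun ω (h : y < σ ω) => lt_of_le_of_lt hxy h)
  have hF : KarAdm (fun x => (P {ω | x < σ ω}).toReal) := by
    refine ⟨fun _ _ => ENNReal.toReal_nonneg, fun s hs => ?_⟩
    have h1 := (kar_adm_const zero_le_one).2 s hs
    simp only [mul_one] at h1
    refine Integrable.mul_bdd (c := 1) h1 hanti.measurable.aestronglyMeasurable ?_
    refine Eventually.of_forall fun x => ?_
    rw [Real.norm_eq_abs, abs_of_nonneg ENNReal.toReal_nonneg]
    exact measureReal_le_one
  have hpos : ∀ᶠ s : ℝ in nhdsWithin 0 (Ioi 0), 0 < s := eventually_mem_nhdsWithin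
  have main := kar_monotone_density hF hanti hρ0 hρ1 hC ?_
  · have h3 : Tendsto (fun y : ℝ => 1 / y) atTop (nhdsWithin 0 (Ioi 0)) := by
      simpa using tendsto_inv_atTop_nhdsGT_zero (𝕜 := ℝ)
    have h4 := (main.comp h3).div_const C
    rw [div_self hC.ne'] at h4
    refine h4.congr' ?_
    filter_upwards [eventually_gt_atTop 0] with y hy
    have hy' := rpow_pos_of_pos hy ρ
    simp only [Function.comp_apply, one_div, inv_inv]
    rw [inv_rpow hy.le, rpow_neg hy.le]
    field_simp
  · intro k
    have hk : (0:ℝ) < k + 1 := by positivity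
    have hval : ∫ x in Ioi (0:ℝ), exp (-(((k + 1) * 1) * x)) * (C * x ^ (-ρ))
        = c * ((k:ℝ) + 1) ^ (ρ - 1) := by
      have := Real.integral_rpow_mul_exp_neg_mul_Ioi hi0 hk
      have e : ∀ x : ℝ, exp (-((((k:ℝ) + 1) * 1) * x)) * (C * x ^ (-ρ))
          = C * (x ^ (1 / α - 1) * exp (-(((k:ℝ) + 1) * x))) := by
        intro x
        rw [mul_one, show -ρ = 1 / α - 1 by rw [hρ]; ring]; ring
      simp only [e]
      rw [integral_const_mul, this, one_div, inv_rpow hk.le, ← rpow_neg hk.le, hCdef,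
        show ρ - 1 = -α⁻¹ by rw [hρ]; ring]
      rw [one_div] at hG
      field_simp
    rw [hval]
    have h5 : Tendsto (fun s : ℝ => ((k:ℝ) + 1) * s) (nhdsWithin 0 (Ioi 0))
        (nhdsWithin 0 (Ioi 0)) := by
      refine tendsto_nhdsWithin_iff.2 ⟨?_, ?_⟩
      · have : Tendsto (fun s : ℝ => ((k:ℝ) + 1) * s) (nhds 0) (nhds (((k:ℝ) + 1) * 0)) :=
          (continuous_const.mul continuous_id).tendsto 0
        rw [mul_zero] at this
        exact this.mono_left nhdsWithin_le_nhds
      · filter_upwards [hpos] with s hs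
        exact mul_pos hk hs
    have h6 := (hLap.comp h5).const_mul (c * ((k:ℝ) + 1) ^ (ρ - 1))
    rw [mul_one] at h6
    refine h6.congr' ?_
    filter_upwards [hpos] with s hs
    rw [kar_layercake P σ hσmeas hσ0 (mul_pos hk hs) hF]
    simp only [Function.comp_apply]
    rw [mul_rpow hk.le hs.le, rpow_sub hs 1 ρ, rpow_sub hk ρ 1, rpow_one, rpow_one]
    have := rpow_pos_of_pos hs ρ
    have := rpow_pos_of_pos hk ρ
    field_simp
end
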